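/- If infinite words x and y are finite-state independent, then every suffix of x is finite-state independent of every suffix of y. -/

import Mathlib

open Filter Topology

namespace FSI

variable {A B D Q : Type*}

/-- The prefix of length `n` of the infinite word `x`. -/
def pref (x : ℕ → A) (n : ℕ) : List A := (List.range n).map x

/-- Number of (possibly overlapping) occurrences of `u` in `w`. -/
noncomputable def occ (w u : List A) : ℕ :=
  Nat.card {i : ℕ | i + u.length ≤ w.length ∧ (w.drop i).take u.length = u}

/-- Number of aligned occurrences of `u` in `w`. -/
noncomputable def alocc (w u : List A) : ℕ :=
  Nat.card {i : ℕ | i + u.length ≤ w.length ∧ i % u.length = 0 ∧ (w.drop i).take u.length = u}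

/-- `x` is simply normal to word length `ℓ`. -/
def SimplyNormalTo [Fintype A] (x : ℕ → A) (ℓ : ℕ) : Prop :=
  ∀ u : List A, u.length = ℓ →
    Tendsto (fun n : ℕ => (alocc (pref x (n * ℓ)) u : ℝ) / n) atTop
      (nhds ((Fintype.card A : ℝ)⁻¹ ^ ℓ))

/-- `x` is a normal infinite word. -/
def Normal [Fintype A] (x : ℕ → A) : Prop := ∀ ℓ : ℕ, 1 ≤ ℓ → SimplyNormalTo x ℓ

/-! ### Two-tape automata -/

/-- A `2`-automaton with input alphabets `A`, `B` and state set `Q`;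
`none` plays the role of the empty word `ε` in transition labels. -/
structure TwoAut (A B Q : Type*) where
  init : Set Q
  trans : Set (Q × (Option A × Option B) × Q)

/-- The support of a label. -/
def lsupp (l : Option A × Option B) : Bool × Bool := (l.1.isSome, l.2.isSome)

/-- A `2`-deterministic `2`-automaton. -/
def TwoAut.TwoDet (M : TwoAut A B Q) : Prop :=
  (∃ q₀, M.init = {q₀}) ∧
  ∀ t ∈ M.trans, ∀ t' ∈ M.trans, t.1 = t'.1 →
    lsupp t.2.1 = lsupp t'.2.1 ∧ (t.2.1 = t'.2.1 → t = t')

/-- A `1`-deterministic `2`-automaton. -/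
def TwoAut.OneDet (M : TwoAut A B Q) : Prop :=
  (∃ q₀, M.init = {q₀}) ∧
  ∀ t ∈ M.trans, ∀ t' ∈ M.trans, t.1 = t'.1 →
    t.2.1.1.isSome = t'.2.1.1.isSome ∧ (t.2.1.1 = t'.2.1.1 → t = t')

/-- `2`-completeness. -/
def TwoAut.TwoComplete (M : TwoAut A B Q) : Prop :=
  ∀ (q : Q) (l l' : Option A × Option B),
    (∃ q', (q, l, q') ∈ M.trans) → lsupp l' = lsupp l → ∃ q', (q, l', q') ∈ M.trans

/-- Every transition reads exactly one symbol. -/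
def TwoAut.OneSymbol (M : TwoAut A B Q) : Prop :=
  ∀ t ∈ M.trans, lsupp t.2.1 = (true, false) ∨ lsupp t.2.1 = (false, true)

def TwoAut.Step (M : TwoAut A B Q) (p q : Q) : Prop := ∃ l, (p, l, q) ∈ M.trans

/-- There is a finite run from `p` to `q`. -/
def TwoAut.Reaches (M : TwoAut A B Q) : Q → Q → Prop := Relation.ReflTransGen M.Step

def TwoAut.StronglyConnected (M : TwoAut A B Q) : Prop := ∀ p q, M.Reaches p q

/-- Word read on the first tape by the first `n` transitions of `γ`. -/
def in1 (γ : ℕ → Q × (Option A × Option B) × Q) (n : ℕ) : List A :=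
  ((List.range n).map fun i => (γ i).2.1.1).reduceOption

/-- Word read on the second tape by the first `n` transitions of `γ`. -/
def in2 (γ : ℕ → Q × (Option A × Option B) × Q) (n : ℕ) : List B :=
  ((List.range n).map fun i => (γ i).2.1.2).reduceOption

/-- `γ` is an infinite run of `M` (not necessarily from the initial state) whose
two input labels are the infinite words `x` and `y`. -/
def TwoAut.IsRunOn (M : TwoAut A B Q) (γ : ℕ → Q × (Option A × Option B) × Q)
    (x : ℕ → A) (y : ℕ → B) : Prop :=
  (∀ n, γ n ∈ M.trans) ∧ (∀ n, (γ n).2.2 = (γ (n + 1)).1) ∧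
  (∀ n, in1 γ n = pref x (in1 γ n).length) ∧ (∀ n, in2 γ n = pref y (in2 γ n).length) ∧
  Tendsto (fun n => (in1 γ n).length) atTop atTop ∧
  Tendsto (fun n => (in2 γ n).length) atTop atTop

/-- The pair `(x, y)` is accepted by `M`. -/
def TwoAut.Accepts (M : TwoAut A B Q) (x : ℕ → A) (y : ℕ → B) : Prop :=
  ∃ γ, (γ 0).1 ∈ M.init ∧ M.IsRunOn γ x y

/-- Number of occurrences of the state `q` among the first `n` transitions of `γ`. -/
noncomputable def stateCount (γ : ℕ → Q × (Option A × Option B) × Q) (q : Q) (n : ℕ) : ℕ :=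
  Nat.card {i : ℕ | i < n ∧ (γ i).1 = q}

/-- Number of occurrences of the transition `τ` among the first `n` transitions of `γ`. -/
noncomputable def transCount (γ : ℕ → Q × (Option A × Option B) × Q)
    (τ : Q × (Option A × Option B) × Q) (n : ℕ) : ℕ :=
  Nat.card {i : ℕ | i < n ∧ γ i = τ}

/-! ### Markov chain associated with a one-symbol automaton -/

/-- The `(p,q)` entry of the Markov matrix associated with the transition set `T`. -/
noncomputable def markovOf {S : Type*} [Fintype A] [Fintype B]
    (T : Set (S × (Option A × Option B) × S)) (p q : S) : ℝ :=
  (Nat.card {a : A | (p, (some a, none), q) ∈ T} : ℝ) / (Fintype.card A : ℝ) +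
  (Nat.card {b : B | (p, (none, some b), q) ∈ T} : ℝ) / (Fintype.card B : ℝ)

/-- `π` is a stationary distribution for the transition set `T` restricted to the
finite state set `st`. -/
def IsStationaryOn {S : Type*} [Fintype A] [Fintype B]
    (T : Set (S × (Option A × Option B) × S)) (st : Finset S) (π : S → ℝ) : Prop :=
  (∀ s ∈ st, 0 ≤ π s) ∧ (∑ s ∈ st, π s = 1) ∧
  ∀ q ∈ st, (∑ p ∈ st, π p * markovOf T p q) = π q

/-- `π` is a stationary distribution of the Markov chain associated with `M`. -/
def TwoAut.IsStationary [Fintype A] [Fintype B] [Fintype Q]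
    (M : TwoAut A B Q) (π : Q → ℝ) : Prop :=
  IsStationaryOn M.trans Finset.univ π

/-- The frequency property for the pair `(x, y)`: in every strongly connected
`2`-deterministic `2`-automaton (reading one symbol per transition), every infinite run
on a suffix of `x` and a suffix of `y` visits each state with frequency given by the
stationary distribution, and the automaton is `2`-complete. -/
def FreqProp [Fintype A] [Fintype B] (x : ℕ → A) (y : ℕ → B) : Prop :=
  ∀ (Q' : Type) [Fintype Q'] (M : TwoAut A B Q'), M.TwoDet → M.OneSymbol →
    M.StronglyConnected →
    ∀ (i j : ℕ) (γ : ℕ → Q' × (Option A × Option B) × Q'),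
      M.IsRunOn γ (fun n => x (n + i)) (fun n => y (n + j)) →
      M.TwoComplete ∧
      ∃ π : Q' → ℝ, M.IsStationary π ∧
        ∀ q, Tendsto (fun n : ℕ => (stateCount γ q n : ℝ) / n) atTop (nhds (π q))

/-! ### Conditional compressors (2-deterministic 3-automata) -/

/-- A `3`-automaton with two input tapes (alphabets `A` and `B`) and one
output tape (alphabet `D`), with a single initial state. -/
structure Comp3 (A B D Q : Type*) where
  init : Q
  trans : Set (Q × (Option A × Option B) × List D × Q)

/-- `2`-determinism for `3`-automata. -/
def Comp3.TwoDet (C : Comp3 A B D Q) : Prop :=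
  ∀ t ∈ C.trans, ∀ t' ∈ C.trans, t.1 = t'.1 →
    lsupp t.2.1 = lsupp t'.2.1 ∧ (t.2.1 = t'.2.1 → t = t')

def c3in1 (γ : ℕ → Q × (Option A × Option B) × List D × Q) (n : ℕ) : List A :=
  ((List.range n).map fun i => (γ i).2.1.1).reduceOption

def c3in2 (γ : ℕ → Q × (Option A × Option B) × List D × Q) (n : ℕ) : List B :=
  ((List.range n).map fun i => (γ i).2.1.2).reduceOption

def c3out (γ : ℕ → Q × (Option A × Option B) × List D × Q) (n : ℕ) : List D :=
  ((List.range n).map fun i => (γ i).2.2.1).flatten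

/-- `γ` is the accepting run of `C` on the pair `(x, y)`. -/
def Comp3.IsAccRunOn (C : Comp3 A B D Q) (γ : ℕ → Q × (Option A × Option B) × List D × Q)
    (x : ℕ → A) (y : ℕ → B) : Prop :=
  (γ 0).1 = C.init ∧ (∀ n, γ n ∈ C.trans) ∧ (∀ n, (γ n).2.2.2 = (γ (n + 1)).1) ∧
  (∀ n, c3in1 γ n = pref x (c3in1 γ n).length) ∧
  (∀ n, c3in2 γ n = pref y (c3in2 γ n).length) ∧
  Tendsto (fun n => (c3in1 γ n).length) atTop atTop ∧
  Tendsto (fun n => (c3in2 γ n).length) atTop atTop ∧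
  Tendsto (fun n => (c3out γ n).length) atTop atTop

/-- For every fixed second input `y`, the input-output map `x ↦ C(x,y)` is one-to-one. -/
def Comp3.OneToOne (C : Comp3 A B D Q) : Prop :=
  ∀ (x x' : ℕ → A) (y : ℕ → B) γ γ', C.IsAccRunOn γ x y → C.IsAccRunOn γ' x' y →
    (∀ n, ∃ m, c3out γ n <+: c3out γ' m) → (∀ n, ∃ m, c3out γ' n <+: c3out γ m) →
    x = x'

/-- The conditional compression ratio `ρ(x/y)`: the infimum, over all conditional
compressors, of the compression ratio of `x` given the oracle `y`. -/
noncomputable def condRho [Fintype A] [Fintype B] (x : ℕ → A) (y : ℕ → B) : ℝ :=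
  sInf {r : ℝ | ∃ (m d : ℕ), 2 ≤ d ∧ ∃ C : Comp3 A B (Fin d) (Fin m),
    C.TwoDet ∧ C.OneToOne ∧ ∃ γ, C.IsAccRunOn γ x y ∧
      r = Filter.liminf (fun n : ℕ =>
        (((c3out γ n).length : ℝ) * Real.log d) /
        (((c3in1 γ n).length : ℝ) * Real.log (Fintype.card A))) atTop}

/-! ### Compressors (one-to-one 1-deterministic 2-automata) -/

/-- A `2`-automaton with one input tape (alphabet `A`) and one output tape
(alphabet `D`), with a single initial state. -/
structure Comp2 (A D Q : Type*) where
  init : Q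
  trans : Set (Q × Option A × List D × Q)

def Comp2.OneDet (C : Comp2 A D Q) : Prop :=
  ∀ t ∈ C.trans, ∀ t' ∈ C.trans, t.1 = t'.1 →
    t.2.1.isSome = t'.2.1.isSome ∧ (t.2.1 = t'.2.1 → t = t')

def c2in (γ : ℕ → Q × Option A × List D × Q) (n : ℕ) : List A :=
  ((List.range n).map fun i => (γ i).2.1).reduceOption

def c2out (γ : ℕ → Q × Option A × List D × Q) (n : ℕ) : List D :=
  ((List.range n).map fun i => (γ i).2.2.1).flatten

def Comp2.IsAccRunOn (C : Comp2 A D Q) (γ : ℕ → Q × Option A × List D × Q)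
    (x : ℕ → A) : Prop :=
  (γ 0).1 = C.init ∧ (∀ n, γ n ∈ C.trans) ∧ (∀ n, (γ n).2.2.2 = (γ (n + 1)).1) ∧
  (∀ n, c2in γ n = pref x (c2in γ n).length) ∧
  Tendsto (fun n => (c2in γ n).length) atTop atTop ∧
  Tendsto (fun n => (c2out γ n).length) atTop atTop

def Comp2.OneToOne (C : Comp2 A D Q) : Prop :=
  ∀ (x x' : ℕ → A) γ γ', C.IsAccRunOn γ x → C.IsAccRunOn γ' x' →
    (∀ n, ∃ m, c2out γ n <+: c2out γ' m) → (∀ n, ∃ m, c2out γ' n <+: c2out γ m) →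
    x = x'

/-- The compression ratio `ρ(x)`. -/
noncomputable def rho [Fintype A] (x : ℕ → A) : ℝ :=
  sInf {r : ℝ | ∃ (m d : ℕ), 2 ≤ d ∧ ∃ C : Comp2 A (Fin d) (Fin m),
    C.OneDet ∧ C.OneToOne ∧ ∃ γ, C.IsAccRunOn γ x ∧
      r = Filter.liminf (fun n : ℕ =>
        (((c2out γ n).length : ℝ) * Real.log d) /
        (((c2in γ n).length : ℝ) * Real.log (Fintype.card A))) atTop}

/-- Finite-state independence. -/
def FSIndep [Fintype A] [Fintype B] (x : ℕ → A) (y : ℕ → B) : Prop :=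
  condRho x y = rho x ∧ condRho y x = rho y ∧ 0 < rho x ∧ 0 < rho y

/-! ### Oblivious selectors with two input tapes -/

/-- Types of states of a selector. -/
inductive SelTy | I | II | III

/-- An oblivious selector with first input alphabet `A` and second input alphabet `B`:
at a state of type I it reads the next symbol of the first input and selects it, at a
state of type II it reads the next symbol of the first input without selecting it, and
at a state of type III it reads the next symbol of the second input. -/
structure Sel2 (A B : Type*) where
  states : ℕ
  init : Fin states
  ty : Fin states → SelTy
  δa : Fin states → A → Fin states
  δb : Fin states → B → Fin states

/-- Configuration (current state, symbols read from `x`, symbols read from `y`)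
after `n` steps. -/
def Sel2.cfg (S : Sel2 A B) (x : ℕ → A) (y : ℕ → B) : ℕ → Fin S.states × ℕ × ℕ
  | 0 => (S.init, 0, 0)
  | n + 1 =>
    let c := S.cfg x y n
    match S.ty c.1 with
    | SelTy.I => (S.δa c.1 (x c.2.1), c.2.1 + 1, c.2.2)
    | SelTy.II => (S.δa c.1 (x c.2.1), c.2.1 + 1, c.2.2)
    | SelTy.III => (S.δb c.1 (y c.2.2), c.2.1, c.2.2 + 1)

/-- The word selected from `x` during the first `n` steps. -/
def Sel2.outList (S : Sel2 A B) (x : ℕ → A) (y : ℕ → B) (n : ℕ) : List A :=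
  (List.range n).filterMap fun i =>
    let c := S.cfg x y i
    match S.ty c.1 with
    | SelTy.I => some (x c.2.1)
    | SelTy.II => none
    | SelTy.III => none

/-! ### Oblivious one-input selection automata -/

/-- An oblivious selection automaton with a single input tape. -/
structure Sel1 (B : Type*) where
  states : ℕ
  init : Fin states
  sel : Fin states → Bool
  δ : Fin states → B → Fin states

/-- State after reading the first `n` symbols of `y`. -/
def Sel1.st (S : Sel1 B) (y : ℕ → B) : ℕ → Fin S.states
  | 0 => S.init
  | n + 1 => S.δ (S.st y n) (y n)

/-- The word selected from the first `n` symbols of `y`. -/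
def Sel1.outList (S : Sel1 B) (y : ℕ → B) (n : ℕ) : List B :=
  (List.range n).filterMap fun i => if S.sel (S.st y i) then some (y i) else none

/-! ### Shufflers -/

/-- A shuffler over the alphabet `A`: at a state of type I it reads, outputs and moves
on the next symbol of the first input; at a state of type II it does so with the second
input. -/
structure Shuffler (A : Type*) where
  states : ℕ
  init : Fin states
  tyI : Fin states → Bool
  δ : Fin states → A → Fin states

/-- Configuration (current state, symbols read from `x`, symbols read from `y`)
after `n` steps. -/
def Shuffler.cfg (S : Shuffler A) (x y : ℕ → A) : ℕ → Fin S.states × ℕ × ℕ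
  | 0 => (S.init, 0, 0)
  | n + 1 =>
    let c := S.cfg x y n
    if S.tyI c.1 then (S.δ c.1 (x c.2.1), c.2.1 + 1, c.2.2)
    else (S.δ c.1 (y c.2.2), c.2.1, c.2.2 + 1)

/-- The output `S(x,y)` of the shuffler `S` on inputs `x` and `y`. -/
def Shuffler.out (S : Shuffler A) (x y : ℕ → A) (n : ℕ) : A :=
  let c := S.cfg x y n
  if S.tyI c.1 then x c.2.1 else y c.2.2

/-! ### Look-ahead automata -/

/-- The transitions of the look-ahead automaton `𝒜_{k,ℓ}`. -/
def lookTrans (M : TwoAut A B Q) (k ℓ : ℕ) :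
    Set ((Q × List A × List B) × (Option A × Option B) × (Q × List A × List B)) :=
  {t | (∃ (q : Q) (u : List A) (a : A), u.length < k ∧
          t = ((q, u, []), (some a, none), (q, u ++ [a], ([] : List B)))) ∨
       (∃ (q : Q) (u : List A) (v : List B) (b : B), u.length = k ∧ v.length < ℓ ∧
          t = ((q, u, v), (none, some b), (q, u, v ++ [b]))) ∨
       (∃ (q q' : Q) (a a' : A) (u' : List A) (v : List B),
          u'.length = k - 1 ∧ v.length = ℓ ∧ (q, (some a, none), q') ∈ M.trans ∧
          t = ((q, a :: u', v), (some a', none), (q', u' ++ [a'], v))) ∨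
       (∃ (q q' : Q) (b b' : B) (u : List A) (v' : List B),
          u.length = k ∧ v'.length = ℓ - 1 ∧ (q, (none, some b), q') ∈ M.trans ∧
          t = ((q, u, b :: v'), (none, some b'), (q', u, v' ++ [b'])))}

/-- The (finite) set of states of the look-ahead automaton with full buffers,
i.e. `Q × A^k × B^ℓ`. -/
noncomputable def fullFinset (Q A B : Type*) [Fintype Q] [Fintype A] [Fintype B]
    (k ℓ : ℕ) : Finset (Q × List A × List B) :=
  letI := Classical.decEq (Q × List A × List B)
  (Finset.univ : Finset (Q × (Fin k → A) × (Fin ℓ → B))).image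
    fun s => (s.1, List.ofFn s.2.1, List.ofFn s.2.2)

/-! ### Counting words and measures -/

/-- The number of words of length `n` with exactly `i` occurrences of `γ`. -/
noncomputable def Ncount (γ : List A) (i n : ℕ) : ℕ :=
  Nat.card {w : List A // w.length = n ∧ occ w γ = i}

/-- The cylinder of infinite words starting with `w`. -/
def cylinder (w : List A) : Set (ℕ → A) := {x : ℕ → A | pref x w.length = w}

/-- The set `E_S(ε,γ,n)` of pairs of inputs for which the frequency of `γ` in the first
`n` symbols of `S(x,y)` deviates from `|A|^{-|γ|}` by less than `ε`. -/
def Eset [Fintype A] (S : Shuffler A) (ε : ℝ) (γ : List A) (n : ℕ) :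
    Set ((ℕ → A) × (ℕ → A)) :=
  {p : (ℕ → A) × (ℕ → A) |
    |(occ (pref (S.out p.1 p.2) n) γ : ℝ) - (n : ℝ) / (Fintype.card A : ℝ) ^ γ.length|
      < ε * n}

/-- The set `F(ε,t,ℓ,n)`. -/
def Fset [Fintype A] (S : ℕ → Shuffler A) (ε : ℝ) (t ℓ n : ℕ) :
    Set ((ℕ → A) × (ℕ → A)) :=
  ⋂ i ∈ Finset.Icc 1 t, ⋂ r ∈ Finset.Icc 1 ℓ,
    ⋂ γ ∈ {γ : List A | γ.length = r}, Eset (S i) ε γ n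

/-- `ℓ_n = (log_{|A|} n)/3`. -/
noncomputable def ellSeq (A : Type*) [Fintype A] (n : ℕ) : ℝ :=
  Real.logb (Fintype.card A) n / 3

/-- `ε_n = 2 √((log n · log_{|A|} n)/n)`. -/
noncomputable def epsSeq (A : Type*) [Fintype A] (n : ℕ) : ℝ :=
  2 * Real.sqrt (Real.log n * Real.logb (Fintype.card A) n / n)

/-- `F_n = F(ε_n, t_n, ℓ_n, n)` with `t_n = n`. -/
noncomputable def Fn [Fintype A] (S : ℕ → Shuffler A) (n : ℕ) :
    Set ((ℕ → A) × (ℕ → A)) :=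
  Fset S (epsSeq A n) n (⌊ellSeq A n⌋).toNat n

/-- `n_start`, the least `n` such that `ε_n ≥ 6/⌊n/ℓ_n⌋`. -/
noncomputable def nStart (A : Type*) [Fintype A] : ℕ :=
  sInf {m : ℕ | 0 < ⌊(m : ℝ) / ellSeq A m⌋ ∧
    6 / ((⌊(m : ℝ) / ellSeq A m⌋ : ℤ) : ℝ) ≤ epsSeq A m}

/-- `G_n = ⋂_{j=0}^{n} F_{|A|^{n_0+j}}` where `|A|^{n_0} = n_start`. -/
noncomputable def Gn [Fintype A] (S : ℕ → Shuffler A) (n : ℕ) :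
    Set ((ℕ → A) × (ℕ → A)) :=
  ⋂ j ∈ Finset.range (n + 1), Fn S (nStart A * Fintype.card A ^ j)


/-! ### Sequences and prefixes -/

/-- The infinite word `x` preceded by an optional symbol. -/
def prepend : Option A → (ℕ → A) → ℕ → A
  | none, x => x
  | some a, x => fun n => Nat.casesOn n a x

/-- The suffix of `x` obtained by dropping the first `i` symbols. -/
def dropSeq (i : ℕ) (x : ℕ → A) : ℕ → A := fun n => x (n + i)

theorem prepend_injective (o : Option A) : Function.Injective (prepend o) := by
  intro x x' h
  cases o with
  | none => exact h
  | some a => exact funext fun n => congrFun h (n + 1)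

theorem prepend_head_dropSeq (x : ℕ → A) : prepend (some (x 0)) (dropSeq 1 x) = x := by
  funext n
  cases n <;> rfl

theorem dropSeq_dropSeq (i k : ℕ) (x : ℕ → A) : dropSeq i (dropSeq k x) = dropSeq (i + k) x :=
  funext fun n => congrArg x (Nat.add_assoc n i k)

theorem dropSeq_prepend (o : Option A) (k : ℕ) (x : ℕ → A) :
    dropSeq (k + o.toList.length) (prepend o x) = dropSeq k x := by
  cases o <;> rfl

theorem pref_succ (x : ℕ → A) (n : ℕ) : pref x (n + 1) = x 0 :: pref (dropSeq 1 x) n := by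
  simp [pref, List.range_succ_eq_map, dropSeq, Function.comp_def]

/-- The word read in the first `n` steps of `γ` through the reading function `f`. -/
def reads {T : Type*} (f : T → Option A) (γ : ℕ → T) (n : ℕ) : List A :=
  ((List.range n).map fun i => f (γ i)).reduceOption

/-- The word written in the first `n` steps of `γ` through the writing function `g`. -/
def writes {T : Type*} (g : T → List D) (γ : ℕ → T) (n : ℕ) : List D :=
  ((List.range n).map fun i => g (γ i)).flatten

section
variable {T : Type*}

theorem reads_zero (f : T → Option A) (γ : ℕ → T) : reads f γ 0 = [] := rfl

theorem reads_succ (f : T → Option A) (γ : ℕ → T) (n : ℕ) :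
    reads f γ (n + 1) = (f (γ 0)).toList ++ reads f (dropSeq 1 γ) n := by
  unfold reads
  cases h : f (γ 0) <;>
    simp [List.range_succ_eq_map, h, dropSeq, Function.comp_def,
      List.reduceOption_cons_of_some, List.reduceOption_cons_of_none]

theorem writes_succ (g : T → List D) (γ : ℕ → T) (n : ℕ) :
    writes g γ (n + 1) = g (γ 0) ++ writes g (dropSeq 1 γ) n := by
  simp [writes, List.range_succ_eq_map, dropSeq, Function.comp_def]

theorem writes_prefix_succ (g : T → List D) (γ : ℕ → T) (n : ℕ) :
    writes g γ n <+: writes g γ (n + 1) := by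
  simp [writes, List.range_succ]

theorem tendsto_const_add_nat_iff {u : ℕ → ℕ} (c : ℕ) :
    Tendsto (fun n => c + u n) atTop atTop ↔ Tendsto u atTop atTop := by
  simp only [tendsto_atTop]
  refine ⟨fun h b => (h (c + b)).mono fun n hn => by omega,
    fun h b => (h b).mono fun n hn => by omega⟩

theorem tendsto_length_reads_iff (f : T → Option A) (γ : ℕ → T) :
    Tendsto (fun n => (reads f γ n).length) atTop atTop ↔
      Tendsto (fun n => (reads f (dropSeq 1 γ) n).length) atTop atTop := by
  rw [← tendsto_add_atTop_iff_nat 1]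
  simp only [reads_succ, List.length_append]
  exact tendsto_const_add_nat_iff _

theorem tendsto_length_writes_iff (g : T → List D) (γ : ℕ → T) :
    Tendsto (fun n => (writes g γ n).length) atTop atTop ↔
      Tendsto (fun n => (writes g (dropSeq 1 γ) n).length) atTop atTop := by
  rw [← tendsto_add_atTop_iff_nat 1]
  simp only [writes_succ, List.length_append]
  exact tendsto_const_add_nat_iff _

/-- The sequence `γ` reads prefixes of `x` through the reading function `f`. -/
def ReadsPrefixes (f : T → Option A) (γ : ℕ → T) (x : ℕ → A) : Prop :=
  ∀ n, reads f γ n = pref x (reads f γ n).length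

theorem readsPrefixes_prepend_iff (f : T → Option A) (γ : ℕ → T) (x : ℕ → A) :
    ReadsPrefixes f γ (prepend (f (γ 0)) x) ↔ ReadsPrefixes f (dropSeq 1 γ) x := by
  have key : ∀ n, reads f γ (n + 1) = pref (prepend (f (γ 0)) x) (reads f γ (n + 1)).length ↔
      reads f (dropSeq 1 γ) n = pref x (reads f (dropSeq 1 γ) n).length := by
    intro n
    rw [reads_succ]
    cases f (γ 0) with
    | none => simp [prepend]
    | some a =>
      have ht : dropSeq 1 (prepend (some a) x) = x := rfl
      have hh : prepend (some a) x 0 = a := rfl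
      simp [pref_succ, ht, hh]
  refine ⟨fun h n => (key n).1 (h (n + 1)), fun h n => ?_⟩
  cases n with
  | zero => rfl
  | succ n => exact (key n).2 (h n)

theorem ReadsPrefixes.exists_prepend {f : T → Option A} {γ : ℕ → T} {z : ℕ → A}
    (h : ReadsPrefixes f γ z) : ∃ x, z = prepend (f (γ 0)) x := by
  have h1 := h 1
  rw [reads_succ, reads_zero] at h1
  cases hf : f (γ 0) with
  | none => exact ⟨z, rfl⟩
  | some a =>
    have : a = z 0 := by simpa [hf, pref] using h1
    exact ⟨dropSeq 1 z, by rw [this, prepend_head_dropSeq]⟩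

/-- Every word written by `γ` is a prefix of a word written by `γ'`. -/
def WritesInto (g : T → List D) (γ γ' : ℕ → T) : Prop :=
  ∀ n, ∃ m, writes g γ n <+: writes g γ' m

theorem writesInto_iff_dropSeq {g : T → List D} {γ γ' : ℕ → T} (h0 : g (γ 0) = g (γ' 0)) :
    WritesInto g γ γ' ↔ WritesInto g (dropSeq 1 γ) (dropSeq 1 γ') := by
  constructor
  · intro h n
    obtain ⟨m, hm⟩ := h (n + 1)
    refine ⟨m, ?_⟩
    have := hm.trans (writes_prefix_succ g γ' m)
    rwa [writes_succ, writes_succ, h0, List.prefix_append_right_inj] at this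
  · intro h n
    cases n with
    | zero => exact ⟨0, List.prefix_rfl⟩
    | succ n =>
      obtain ⟨m, hm⟩ := h n
      exact ⟨m + 1, by rwa [writes_succ, writes_succ, h0, List.prefix_append_right_inj]⟩

theorem writesInto_prepend_iff {g : T → List D} {γ γ' : ℕ → T} (t : T) :
    WritesInto g (prepend (some t) γ) (prepend (some t) γ') ↔ WritesInto g γ γ' :=
  writesInto_iff_dropSeq rfl

end

/-! ### Limits inferior of ratios -/

theorem bddAbove_and_liminf_le {F G : ℕ → ℝ} (hF : ∀ n, 0 ≤ F n)
    (hFG : ∀ ε > 0, ∀ᶠ n in atTop, F n ≤ (1 + ε) * G n)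
    (hG : BddAbove {a | ∀ᶠ n in atTop, a ≤ G n}) :
    BddAbove {a | ∀ᶠ n in atTop, a ≤ F n} ∧ liminf F atTop ≤ liminf G atTop := by
  have key : ∀ a, (∀ᶠ n in atTop, a ≤ F n) → ∀ ε > 0, ∀ᶠ n in atTop, a / (1 + ε) ≤ G n := by
    intro a ha ε hε
    filter_upwards [ha, hFG ε hε] with n h1 h2
    rw [div_le_iff₀ (by positivity)]
    linarith
  refine ⟨?_, ?_⟩
  · obtain ⟨M, hM⟩ := hG
    refine ⟨M * (1 + 1), fun a ha => ?_⟩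
    rw [← div_le_iff₀ (by norm_num)]
    exact hM (key a ha 1 one_pos)
  · rw [liminf_eq, liminf_eq]
    set s := sSup {a | ∀ᶠ n in atTop, a ≤ G n}
    have hF0 : ∀ᶠ n in atTop, (0 : ℝ) ≤ F n := Eventually.of_forall hF
    have hs : ∀ a, (∀ᶠ n in atTop, a ≤ F n) → ∀ ε > 0, a ≤ s * (1 + ε) := by
      intro a ha ε hε
      rw [← div_le_iff₀ (by positivity)]
      exact le_csSup hG (key a ha ε hε)
    have hs0 : 0 ≤ s := by linarith [hs 0 hF0 1 one_pos]
    refine csSup_le ⟨0, hF0⟩ fun a ha => ?_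
    by_contra! hlt
    have hpos : 0 < (a - s) / (s + 1) := div_pos (by linarith) (by linarith)
    have hmul : (a - s) / (s + 1) * (s + 1) = a - s := div_mul_cancel₀ _ (by linarith)
    nlinarith [hs a ha _ hpos]

theorem liminf_eq_of_eventually_le_mul {F G : ℕ → ℝ} (hF : ∀ n, 0 ≤ F n) (hG : ∀ n, 0 ≤ G n)
    (hFG : ∀ ε > 0, ∀ᶠ n in atTop, F n ≤ (1 + ε) * G n)
    (hGF : ∀ ε > 0, ∀ᶠ n in atTop, G n ≤ (1 + ε) * F n) :
    liminf F atTop = liminf G atTop := by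
  by_cases hb : BddAbove {a | ∀ᶠ n in atTop, a ≤ G n}
  · have h1 := bddAbove_and_liminf_le hF hFG hb
    exact le_antisymm h1.2 (bddAbove_and_liminf_le hG hGF h1.1).2
  · have hb' : ¬ BddAbove {a | ∀ᶠ n in atTop, a ≤ F n} := fun h =>
      hb (bddAbove_and_liminf_le hG hGF h).1
    rw [liminf_eq, liminf_eq, Real.sSup_of_not_bddAbove hb, Real.sSup_of_not_bddAbove hb']

theorem eventually_natCast_le_mul {u : ℕ → ℕ} (hu : Tendsto u atTop atTop) (c : ℕ) {ε : ℝ}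
    (hε : 0 < ε) : ∀ᶠ n in atTop, ((c + u n : ℕ) : ℝ) ≤ (1 + ε) * u n := by
  obtain ⟨N, hN⟩ := exists_nat_ge ((c : ℝ) / ε)
  filter_upwards [hu.eventually_ge_atTop N] with n hn
  have h1 : (c : ℝ) / ε ≤ u n := hN.trans (by exact_mod_cast hn)
  rw [div_le_iff₀ hε] at h1
  push_cast
  linarith

theorem liminf_ratio_const_add {u v : ℕ → ℕ} (hu : Tendsto u atTop atTop)
    (hv : Tendsto v atTop atTop) (c c' : ℕ) {L K : ℝ} (hL : 0 ≤ L) (hK : 0 ≤ K) :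
    liminf (fun n => ((c + u n : ℕ) : ℝ) * L / (((c' + v n : ℕ) : ℝ) * K)) atTop =
      liminf (fun n => (u n : ℝ) * L / ((v n : ℝ) * K)) atTop := by
  rcases hK.eq_or_lt with rfl | hK
  · simp
  refine liminf_eq_of_eventually_le_mul (fun n => by positivity) (fun n => by positivity) ?_ ?_
  · intro ε hε
    filter_upwards [eventually_natCast_le_mul hu c hε, hv.eventually_ge_atTop 1] with n h1 h2
    have hv0 : (0 : ℝ) < v n := by exact_mod_cast h2
    calc ((c + u n : ℕ) : ℝ) * L / (((c' + v n : ℕ) : ℝ) * K)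
        ≤ ((1 + ε) * u n) * L / ((v n : ℝ) * K) := by
          gcongr
          omega
      _ = (1 + ε) * ((u n : ℝ) * L / ((v n : ℝ) * K)) := by ring
  · intro ε hε
    filter_upwards [eventually_natCast_le_mul hv c' hε, hv.eventually_ge_atTop 1] with n h1 h2
    have hv0 : (0 : ℝ) < v n := by exact_mod_cast h2
    have hv1 : (0 : ℝ) < ((c' + v n : ℕ) : ℝ) := by exact_mod_cast (by omega : 0 < c' + v n)
    rw [← mul_div_assoc, div_le_div_iff₀ (by positivity) (by positivity)]
    have hc : (u n : ℝ) ≤ ((c + u n : ℕ) : ℝ) := by exact_mod_cast Nat.le_add_left _ _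
    calc (u n : ℝ) * L * (((c' + v n : ℕ) : ℝ) * K)
        ≤ ((c + u n : ℕ) : ℝ) * L * (((1 + ε) * v n) * K) := by gcongr
      _ = (1 + ε) * (((c + u n : ℕ) : ℝ) * L) * ((v n : ℝ) * K) := by ring

/-! ### Compressors over an arbitrary label alphabet -/

section
variable {L σ : Type*}

/-- Transitions from `Q` to `Q` with input label in `L` and output word over `D`. -/
abbrev Trans (L D Q : Type*) := Q × L × List D × Q

/-- Determinism of the transition set `T`, relative to the support function `s` of labels. -/
def Det (s : L → σ) (T : Set (Trans L D Q)) : Prop :=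
  ∀ t ∈ T, ∀ t' ∈ T, t.1 = t'.1 → s t.2.1 = s t'.2.1 ∧ (t.2.1 = t'.2.1 → t = t')

/-- `γ` is a path from `q` in the transition set `T`. -/
def IsPath (q : Q) (T : Set (Trans L D Q)) (γ : ℕ → Trans L D Q) : Prop :=
  (γ 0).1 = q ∧ (∀ n, γ n ∈ T) ∧ ∀ n, (γ n).2.2.2 = (γ (n + 1)).1

/-- `γ` is an accepting run from `q` on the pair `(x, y)`, where `f` and `g` give the symbols
of the two input tapes read by a label. -/
def IsAcc (f : L → Option A) (g : L → Option B) (q : Q) (T : Set (Trans L D Q))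
    (γ : ℕ → Trans L D Q) (x : ℕ → A) (y : ℕ → B) : Prop :=
  IsPath q T γ ∧
  ReadsPrefixes (fun t => f t.2.1) γ x ∧
  ReadsPrefixes (fun t => g t.2.1) γ y ∧
  Tendsto (fun n => (reads (fun t => f t.2.1) γ n).length) atTop atTop ∧
  Tendsto (fun n => (reads (fun t => g t.2.1) γ n).length) atTop atTop ∧
  Tendsto (fun n => (writes (fun t => t.2.2.1) γ n).length) atTop atTop

/-- For every second input, the map from first inputs to outputs is one-to-one. -/
def Inj (f : L → Option A) (g : L → Option B) (q : Q) (T : Set (Trans L D Q)) : Prop :=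
  ∀ (x x' : ℕ → A) (y : ℕ → B) γ γ', IsAcc f g q T γ x y → IsAcc f g q T γ' x' y →
    WritesInto (fun t => t.2.2.1) γ γ' → WritesInto (fun t => t.2.2.1) γ' γ → x = x'

/-- The compression ratio of the run `γ`. -/
noncomputable def ratio [Fintype A] {d : ℕ} (f : L → Option A)
    (γ : ℕ → Trans L (Fin d) Q) : ℝ :=
  liminf (fun n : ℕ => (((writes (fun t => t.2.2.1) γ n).length : ℝ) * Real.log d) /
    (((reads (fun t => f t.2.1) γ n).length : ℝ) * Real.log (Fintype.card A))) atTop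

/-- The set of compression ratios of `x` with oracle `y`. -/
def ratios [Fintype A] (s : L → σ) (f : L → Option A) (g : L → Option B)
    (x : ℕ → A) (y : ℕ → B) : Set ℝ :=
  {r | ∃ m d : ℕ, 2 ≤ d ∧ ∃ (q : Fin m) (T : Set (Trans L (Fin d) (Fin m))),
    Det s T ∧ Inj f g q T ∧ ∃ γ, IsAcc f g q T γ x y ∧ r = ratio f γ}

variable {s : L → σ} {f : L → Option A} {g : L → Option B} {q : Q} {T : Set (Trans L D Q)}
  {γ γ' : ℕ → Trans L D Q} {x x' : ℕ → A} {y : ℕ → B}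

theorem isPath_iff_dropSeq :
    IsPath q T γ ↔ (γ 0).1 = q ∧ γ 0 ∈ T ∧ IsPath (γ 0).2.2.2 T (dropSeq 1 γ) := by
  constructor
  · rintro ⟨h0, hT, hs⟩
    exact ⟨h0, hT 0, (hs 0).symm, fun n => hT (n + 1), fun n => hs (n + 1)⟩
  · rintro ⟨h0, hT0, h1, hT, hs⟩
    refine ⟨h0, fun n => ?_, fun n => ?_⟩ <;> cases n
    exacts [hT0, hT _, h1.symm, hs _]

theorem isAcc_prepend_iff :
    IsAcc f g q T γ (prepend (f (γ 0).2.1) x) (prepend (g (γ 0).2.1) y) ↔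
      (γ 0).1 = q ∧ γ 0 ∈ T ∧ IsAcc f g (γ 0).2.2.2 T (dropSeq 1 γ) x y := by
  unfold IsAcc
  rw [isPath_iff_dropSeq, readsPrefixes_prepend_iff (fun t : Trans L D Q => f t.2.1),
    readsPrefixes_prepend_iff (fun t : Trans L D Q => g t.2.1),
    tendsto_length_reads_iff (fun t : Trans L D Q => f t.2.1),
    tendsto_length_reads_iff (fun t : Trans L D Q => g t.2.1), tendsto_length_writes_iff]
  tauto

theorem IsAcc.exists_prepend (h : IsAcc f g q T γ x y) :
    ∃ z w, x = prepend (f (γ 0).2.1) z ∧ y = prepend (g (γ 0).2.1) w ∧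
      (γ 0).1 = q ∧ γ 0 ∈ T ∧ IsAcc f g (γ 0).2.2.2 T (dropSeq 1 γ) z w := by
  obtain ⟨z, rfl⟩ := h.2.1.exists_prepend
  obtain ⟨w, rfl⟩ := h.2.2.1.exists_prepend
  exact ⟨z, w, rfl, rfl, isAcc_prepend_iff.1 h⟩

theorem Inj.of_mem (h : Inj f g q T) {t : Trans L D Q} (ht : t ∈ T) (hq : t.1 = q) :
    Inj f g t.2.2.2 T := by
  intro x x' y γ γ' hγ hγ' ho ho'
  have acc : ∀ {δ z}, IsAcc f g t.2.2.2 T δ z y → IsAcc f g q T (prepend (some t) δ)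
      (prepend (f t.2.1) z) (prepend (g t.2.1) y) := fun hδ =>
    isAcc_prepend_iff.2 ⟨hq, ht, hδ⟩
  exact prepend_injective _ (h _ _ _ _ _ (acc hγ) (acc hγ')
    ((writesInto_prepend_iff t).2 ho) ((writesInto_prepend_iff t).2 ho'))

theorem ratio_dropSeq [Fintype A] {d : ℕ} {q : Q} {T : Set (Trans L (Fin d) Q)}
    {γ : ℕ → Trans L (Fin d) Q} (h : IsAcc f g q T γ x y) :
    ratio f (dropSeq 1 γ) = ratio f γ := by
  obtain ⟨-, -, -, hin, -, hout⟩ := h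
  rw [tendsto_length_reads_iff] at hin
  rw [tendsto_length_writes_iff] at hout
  unfold ratio
  rw [← liminf_ratio_const_add hout hin (γ 0).2.2.1.length (f (γ 0).2.1).toList.length
    (Real.log_natCast_nonneg _) (Real.log_natCast_nonneg _)]
  conv_rhs => rw [← liminf_nat_add _ 1]
  simp only [reads_succ, writes_succ, List.length_append]

theorem exists_le_mem_ratios_dropSeq [Fintype A] {r : ℝ} (h : r ∈ ratios s f g x y) (i j : ℕ) :
    ∃ i' j', i ≤ i' ∧ j ≤ j' ∧ r ∈ ratios s f g (dropSeq i' x) (dropSeq j' y) := by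
  obtain ⟨m, d, hd, q, T, hdet, hinj, γ, hγ, rfl⟩ := h
  have key : ∀ (n : ℕ) (q : Fin m) (γ : ℕ → Trans L (Fin d) (Fin m)) (x : ℕ → A) (y : ℕ → B),
      Inj f g q T → IsAcc f g q T γ x y →
      ratio f γ ∈ ratios s f g (dropSeq (reads (fun t => f t.2.1) γ n).length x)
        (dropSeq (reads (fun t => g t.2.1) γ n).length y) := by
    intro n
    induction n with
    | zero => exact fun q γ x y hinj hγ => ⟨m, d, hd, q, T, hdet, hinj, γ, hγ, rfl⟩
    | succ n ih =>
      intro q γ x y hinj hγ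
      obtain ⟨z, w, rfl, rfl, hq, hT, hz⟩ := hγ.exists_prepend
      have := ih _ _ z w (hinj.of_mem hT hq) hz
      rw [ratio_dropSeq hγ] at this
      rw [reads_succ, reads_succ, List.length_append, List.length_append, Nat.add_comm,
        dropSeq_prepend, Nat.add_comm, dropSeq_prepend]
      exact this
  obtain ⟨n, hi, hj⟩ := ((hγ.2.2.2.1.eventually_ge_atTop i).and
    (hγ.2.2.2.2.1.eventually_ge_atTop j)).exists
  exact ⟨_, _, hi, hj, key n q γ x y hinj hγ⟩

/-! ### Adding an initial transition -/

/-- The transition `t` with its states renamed along `Fin.succ`. -/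
def liftTrans {m : ℕ} (t : Trans L D (Fin m)) : Trans L D (Fin (m + 1)) :=
  (t.1.succ, t.2.1, t.2.2.1, t.2.2.2.succ)

/-- The transition set `T` together with a new state `0` whose only transition has label `l`,
empty output and target `q`. -/
def extend {m : ℕ} (l : L) (q : Fin m) (T : Set (Trans L D (Fin m))) :
    Set (Trans L D (Fin (m + 1))) :=
  insert (0, l, [], q.succ) (liftTrans '' T)

variable {m : ℕ} {l : L} {p : Fin m} {U : Set (Trans L D (Fin m))}

theorem Det.extend (h : Det s U) : Det s (extend l p U) := by
  rintro t (rfl | ⟨t, ht, rfl⟩) t' (rfl | ⟨t', ht', rfl⟩) hq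
  · exact ⟨rfl, fun _ => rfl⟩
  · exact absurd hq.symm (Fin.succ_ne_zero _)
  · exact absurd hq (Fin.succ_ne_zero _)
  · obtain ⟨h1, h2⟩ := h t ht t' ht' (Fin.succ_injective _ hq)
    exact ⟨h1, fun hl => congrArg liftTrans (h2 hl)⟩

theorem eq_of_mem_extend_of_fst_eq_zero {t : Trans L D (Fin (m + 1))} (ht : t ∈ extend l p U)
    (h0 : t.1 = 0) : t = (0, l, [], p.succ) := by
  rcases ht with rfl | ⟨t, -, rfl⟩
  · rfl
  · exact absurd h0 (Fin.succ_ne_zero _)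

theorem exists_of_isPath_extend {q : Fin m} {γ : ℕ → Trans L D (Fin (m + 1))}
    (h : IsPath q.succ (extend l p U) γ) : ∃ δ, IsPath q U δ ∧ γ = fun n => liftTrans (δ n) := by
  obtain ⟨h0, hT, hs⟩ := h
  have hne : ∀ n, (γ n).1 ≠ 0 := by
    intro n
    cases n with
    | zero => exact h0 ▸ Fin.succ_ne_zero _
    | succ n =>
      rw [← hs n]
      rcases hT n with h | ⟨t, -, ht⟩
      · exact h ▸ Fin.succ_ne_zero _
      · exact ht ▸ Fin.succ_ne_zero _
  have hmem : ∀ n, ∃ t ∈ U, liftTrans t = γ n := by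
    intro n
    rcases hT n with h | h
    · exact absurd (congrArg Prod.fst h) (hne n)
    · exact h
  choose δ hδ hγ using hmem
  obtain rfl : (fun n => liftTrans (δ n)) = γ := funext hγ
  exact ⟨δ, ⟨Fin.succ_injective _ h0, hδ, fun n => Fin.succ_injective _ (hs n)⟩, rfl⟩

theorem IsPath.lift {q : Fin m} {δ : ℕ → Trans L D (Fin m)} (h : IsPath q U δ) :
    IsPath q.succ (FSI.extend l p U) fun n => liftTrans (δ n) :=
  ⟨congrArg Fin.succ h.1, fun n => Or.inr ⟨_, h.2.1 n, rfl⟩,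
    fun n => congrArg Fin.succ (h.2.2 n)⟩

theorem exists_of_isAcc_extend {γ : ℕ → Trans L D (Fin (m + 1))}
    (h : IsAcc f g 0 (extend l p U) γ x y) :
    ∃ δ z w, x = prepend (f l) z ∧ y = prepend (g l) w ∧ IsAcc f g p U δ z w ∧
      γ = prepend (some (0, l, [], p.succ)) fun n => liftTrans (δ n) := by
  obtain ⟨z, w, rfl, rfl, h0, hT, hz⟩ := h.exists_prepend
  have e := eq_of_mem_extend_of_fst_eq_zero hT h0
  rw [e] at hz
  obtain ⟨δ, hδ, hγ⟩ := exists_of_isPath_extend hz.1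
  refine ⟨δ, z, w, by rw [e], by rw [e], ⟨hδ, ?_⟩, ?_⟩
  · have h2 := hz.2
    rw [hγ] at h2
    exact h2
  · rw [← hγ, ← e, prepend_head_dropSeq]

theorem Inj.extend (h : Inj f g p U) : Inj f g 0 (extend l p U) := by
  intro x x' y γ γ' hγ hγ' ho ho'
  obtain ⟨δ, z, w, rfl, rfl, hδ, rfl⟩ := exists_of_isAcc_extend hγ
  obtain ⟨δ', z', w', rfl, hw, hδ', rfl⟩ := exists_of_isAcc_extend hγ'
  obtain rfl := prepend_injective _ hw
  rw [writesInto_prepend_iff] at ho ho'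
  rw [h z z' w δ δ' hδ hδ' ho ho']

theorem ratio_liftTrans [Fintype A] {d : ℕ} (f : L → Option A)
    (γ : ℕ → Trans L (Fin d) (Fin m)) : ratio f (fun n => liftTrans (γ n)) = ratio f γ :=
  rfl

theorem mem_ratios_prepend [Fintype A] {r : ℝ} (h : r ∈ ratios s f g x y) (l : L) :
    r ∈ ratios s f g (prepend (f l) x) (prepend (g l) y) := by
  obtain ⟨m, d, hd, q, T, hdet, hinj, γ, hγ, rfl⟩ := h
  have hacc : IsAcc f g 0 (extend l q T)
      (prepend (some (0, l, [], q.succ)) fun n => liftTrans (γ n))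
      (prepend (f l) x) (prepend (g l) y) :=
    isAcc_prepend_iff.2 ⟨rfl, Or.inl rfl, hγ.1.lift, hγ.2⟩
  refine ⟨m + 1, d, hd, 0, extend l q T, hdet.extend, hinj.extend, _, hacc, ?_⟩
  rw [← ratio_dropSeq hacc, ← ratio_liftTrans f γ]
  rfl

end

/-! ### Conditional and unconditional compression ratios of suffixes -/

theorem condRho_eq_sInf_ratios [Fintype A] [Fintype B] (x : ℕ → A) (y : ℕ → B) :
    condRho x y = sInf (ratios lsupp Prod.fst Prod.snd x y) := by
  unfold condRho
  congr 1
  ext r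
  constructor
  · rintro ⟨m, d, hd, C, hdet, hinj, γ, ⟨h0, hT, hs, hx, hy, hlim⟩, hr⟩
    exact ⟨m, d, hd, C.init, C.trans, hdet,
      fun x x' y γ γ' hγ hγ' => hinj x x' y γ γ'
        ⟨hγ.1.1, hγ.1.2.1, hγ.1.2.2, hγ.2⟩ ⟨hγ'.1.1, hγ'.1.2.1, hγ'.1.2.2, hγ'.2⟩,
      γ, ⟨⟨h0, hT, hs⟩, hx, hy, hlim⟩, hr⟩
  · rintro ⟨m, d, hd, q, T, hdet, hinj, γ, ⟨⟨h0, hT, hs⟩, hx, hy, hlim⟩, hr⟩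
    exact ⟨m, d, hd, ⟨q, T⟩, hdet,
      fun x x' y γ γ' ⟨h1, h2, h3, h4⟩ ⟨h1', h2', h3', h4'⟩ => hinj x x' y γ γ'
        ⟨⟨h1, h2, h3⟩, h4⟩ ⟨⟨h1', h2', h3'⟩, h4'⟩,
      γ, ⟨h0, hT, hs, hx, hy, hlim⟩, hr⟩

theorem length_reads_some_unit {T : Type*} (γ : ℕ → T) (n : ℕ) :
    (reads (fun _ => some ()) γ n).length = n := by
  induction n generalizing γ with
  | zero => rfl
  | succ n ih => simp [reads_succ, ih]

theorem comp2_isAccRunOn_iff (C : Comp2 A D Q) (γ : ℕ → Q × Option A × List D × Q)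
    (x : ℕ → A) (y : ℕ → Unit) :
    C.IsAccRunOn γ x ↔ IsAcc id (fun _ => some ()) C.init C.trans γ x y := by
  constructor
  · rintro ⟨h0, hT, hs, hx, hin, hout⟩
    refine ⟨⟨h0, hT, hs⟩, hx, fun n => ?_, hin, ?_, hout⟩
    · exact List.ext_getElem (by simp [pref]) fun _ _ _ => rfl
    · simp only [length_reads_some_unit]
      exact tendsto_id
  · rintro ⟨⟨h0, hT, hs⟩, hx, -, hin, -, hout⟩
    exact ⟨h0, hT, hs, hx, hin, hout⟩

theorem rho_eq_sInf_ratios [Fintype A] (x : ℕ → A) (y : ℕ → Unit) :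
    rho x = sInf (ratios Option.isSome id (fun _ => some ()) x y) := by
  unfold rho
  congr 1
  ext r
  constructor
  · rintro ⟨m, d, hd, C, hdet, hinj, γ, hγ, hr⟩
    exact ⟨m, d, hd, C.init, C.trans, hdet,
      fun x x' y γ γ' hγ hγ' => hinj x x' γ γ' ((comp2_isAccRunOn_iff C γ x y).2 hγ)
        ((comp2_isAccRunOn_iff C γ' x' y).2 hγ'),
      γ, (comp2_isAccRunOn_iff C γ x y).1 hγ, hr⟩
  · rintro ⟨m, d, hd, q, T, hdet, hinj, γ, hγ, hr⟩
    exact ⟨m, d, hd, ⟨q, T⟩, hdet,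
      fun x x' γ γ' hγ hγ' => hinj x x' y γ γ' ((comp2_isAccRunOn_iff ⟨q, T⟩ γ x y).1 hγ)
        ((comp2_isAccRunOn_iff ⟨q, T⟩ γ' x' y).1 hγ'),
      γ, (comp2_isAccRunOn_iff ⟨q, T⟩ γ x y).2 hγ, hr⟩

theorem mem_ratios_of_dropSeq_left [Fintype A] {x : ℕ → A} {y : ℕ → B} {r : ℝ} {k : ℕ}
    (h : r ∈ ratios lsupp Prod.fst Prod.snd (dropSeq k x) y) :
    r ∈ ratios lsupp Prod.fst Prod.snd x y := by
  induction k with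
  | zero => exact h
  | succ k ih =>
    apply ih
    rw [Nat.add_comm, ← dropSeq_dropSeq] at h
    have := mem_ratios_prepend h (some (dropSeq k x 0), none)
    rwa [prepend_head_dropSeq] at this

theorem mem_ratios_of_dropSeq_right [Fintype A] {x : ℕ → A} {y : ℕ → B} {r : ℝ} {k : ℕ}
    (h : r ∈ ratios lsupp Prod.fst Prod.snd x (dropSeq k y)) :
    r ∈ ratios lsupp Prod.fst Prod.snd x y := by
  induction k with
  | zero => exact h
  | succ k ih =>
    apply ih
    rw [Nat.add_comm, ← dropSeq_dropSeq] at h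
    have := mem_ratios_prepend h (none, some (dropSeq k y 0))
    rwa [prepend_head_dropSeq] at this

theorem condRho_dropSeq [Fintype A] [Fintype B] (x : ℕ → A) (y : ℕ → B) (i j : ℕ) :
    condRho (dropSeq i x) (dropSeq j y) = condRho x y := by
  rw [condRho_eq_sInf_ratios, condRho_eq_sInf_ratios]
  congr 1
  refine Set.Subset.antisymm
    (fun r h => mem_ratios_of_dropSeq_left (mem_ratios_of_dropSeq_right h)) fun r h => ?_
  obtain ⟨i', j', hi, hj, h'⟩ := exists_le_mem_ratios_dropSeq h i j
  rw [← Nat.sub_add_cancel hi, ← Nat.sub_add_cancel hj, ← dropSeq_dropSeq, ← dropSeq_dropSeq] at h'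
  exact mem_ratios_of_dropSeq_left (mem_ratios_of_dropSeq_right h')

theorem mem_ratios_of_dropSeq [Fintype A] {x : ℕ → A} {y : ℕ → Unit} {r : ℝ} {k : ℕ}
    (h : r ∈ ratios Option.isSome id (fun _ => some ()) (dropSeq k x) y) :
    r ∈ ratios Option.isSome id (fun _ => some ()) x y := by
  induction k with
  | zero => exact h
  | succ k ih =>
    apply ih
    rw [Nat.add_comm, ← dropSeq_dropSeq] at h
    have := mem_ratios_prepend h (some (dropSeq k x 0))
    rwa [id, prepend_head_dropSeq, Subsingleton.elim (prepend _ y) y] at this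

theorem rho_dropSeq [Fintype A] (x : ℕ → A) (i : ℕ) : rho (dropSeq i x) = rho x := by
  rw [rho_eq_sInf_ratios _ fun _ => (), rho_eq_sInf_ratios _ fun _ => ()]
  congr 1
  refine Set.Subset.antisymm (fun r h => mem_ratios_of_dropSeq h) fun r h => ?_
  obtain ⟨i', j', hi, -, h'⟩ := exists_le_mem_ratios_dropSeq h i 0
  rw [← Nat.sub_add_cancel hi, ← dropSeq_dropSeq] at h'
  exact mem_ratios_of_dropSeq h'

/-- If `x` and `y` are finite-state independent then every suffix of
`x` is finite-state independent of every suffix of `y`. -/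
theorem fsIndep_suffixes {A B : Type*} [Fintype A] [Fintype B]
    (x : ℕ → A) (y : ℕ → B) (h : FSIndep x y) (i j : ℕ) :
    FSIndep (fun n => x (n + i)) (fun n => y (n + j)) := by
  obtain ⟨h1, h2, h3, h4⟩ := h
  change FSIndep (dropSeq i x) (dropSeq j y)
  refine ⟨?_, ?_, ?_, ?_⟩ <;> simpa only [condRho_dropSeq, rho_dropSeq]

end FSI
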